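/- Let V be a bicomplex with H_A^i(V) = 0 for all i ≤ k−1 (V is (k−1)-connected). Then for every n ≥ 1 the n-th exterior power ⋀ⁿV (as a bicomplex) satisfies H_A^i(⋀ⁿV) = 0 for all i ≤ nk − 1. -/

import Mathlib

open LinearMap Submodule

section Graded

variable {K V W : Type*} [Field K] [AddCommGroup V] [Module K V] [AddCommGroup W] [Module K W]
  {gV : ℤ → Submodule K V}

theorem exists_linearMap_of_graded (hgV : DirectSum.IsInternal gV) (φ : ℤ → V →ₗ[K] W) :
    ∃ Φ : V →ₗ[K] W, ∀ i, ∀ x ∈ gV i, Φ x = φ i x := by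
  let e := LinearEquiv.ofBijective (DirectSum.coeLinearMap gV) hgV
  refine ⟨DirectSum.toModule K ℤ W (fun i => φ i ∘ₗ (gV i).subtype) ∘ₗ e.symm.toLinearMap, ?_⟩
  intro i x hx
  have he : e.symm x = DirectSum.lof K ℤ (fun i => gV i) i ⟨x, hx⟩ := by
    rw [LinearEquiv.symm_apply_eq]
    exact (DirectSum.coeLinearMap_lof gV i ⟨x, hx⟩).symm
  simp [he]

theorem linearMap_ext_of_graded (hgV : DirectSum.IsInternal gV) {f g : V →ₗ[K] W}
    (h : ∀ i, ∀ x ∈ gV i, f x = g x) : f = g := by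
  have : (⊤ : Submodule K V) ≤ LinearMap.eqLocus f g := by
    rw [← hgV.submodule_iSup_eq_top]
    exact iSup_le fun i x hx => h i x hx
  exact LinearMap.ext fun x => this trivial

/-- The operator acting on degree `i` by `(-1) ^ i`. -/
theorem exists_gradedSign (hgV : DirectSum.IsInternal gV) :
    ∃ s : V →ₗ[K] V, ∀ i, ∀ x ∈ gV i, s x = ((-1 : K) ^ i) • x :=
  exists_linearMap_of_graded hgV fun i => ((-1 : K) ^ i) • LinearMap.id

theorem exists_homogeneous_of_mem_range_sup_range (hgV : DirectSum.IsInternal gV)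
    {d1 d2 : V →ₗ[K] V} (hd1 : ∀ i, (gV i).map d1 ≤ gV (i + 1))
    (hd2 : ∀ i, (gV i).map d2 ≤ gV (i + 1)) {i : ℤ} {x : V} (hx : x ∈ gV i)
    (hxr : x ∈ range d1 ⊔ range d2) :
    ∃ a ∈ gV (i - 1), ∃ b ∈ gV (i - 1), x = d1 a + d2 b := by
  have hp (j : ℤ) : ∃ p : V →ₗ[K] V, ∀ i, ∀ x ∈ gV i, p x = if i = j then x else 0 := by
    obtain ⟨p, hp⟩ := exists_linearMap_of_graded hgV
      fun i => if i = j then (LinearMap.id : V →ₗ[K] V) else 0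
    refine ⟨p, fun i x hx => ?_⟩
    rw [hp i x hx]
    split_ifs <;> rfl
  choose p hp using hp
  have hpd {d : V →ₗ[K] V} (hd : ∀ i, (gV i).map d ≤ gV (i + 1)) :
      p i ∘ₗ d = d ∘ₗ p (i - 1) := by
    refine linearMap_ext_of_graded hgV fun j x hx => ?_
    rw [comp_apply, comp_apply, hp _ _ _ hx, hp _ _ _ (hd j (mem_map_of_mem hx))]
    by_cases h : j + 1 = i
    · rw [if_pos h, if_pos (by omega)]
    · rw [if_neg h, if_neg (by omega), map_zero]
  have hmem (j : ℤ) (x : V) : p j x ∈ gV j := by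
    have : (⊤ : Submodule K V) ≤ (gV j).comap (p j) := by
      rw [← hgV.submodule_iSup_eq_top]
      refine iSup_le fun i x hx => ?_
      rw [mem_comap, hp _ _ _ hx]
      split_ifs with h
      · exact h ▸ hx
      · exact zero_mem _
    exact this trivial
  obtain ⟨_, ⟨a, rfl⟩, _, ⟨b, rfl⟩, rfl⟩ := mem_sup.1 hxr
  refine ⟨p (i - 1) a, hmem _ _, p (i - 1) b, hmem _ _, ?_⟩
  have h := hp i i _ hx
  rw [if_pos rfl] at h
  rw [← comp_apply d1, ← hpd hd1, ← comp_apply d2, ← hpd hd2, comp_apply, comp_apply, ← map_add, h]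

end Graded

section Homotopy

variable {K V : Type*} [Field K] [AddCommGroup V] [Module K V] {gV : ℤ → Submodule K V}
  {d1 d2 : V →ₗ[K] V}

/-- The iterated graded commutator `[d1, [d2, h]]` of an even endomorphism `h`. -/
def doubleCommutator {R : Type*} [Ring R] (d1 d2 h : R) : R :=
  d1 * (d2 * h - h * d2) + (d2 * h - h * d2) * d1

theorem commute_doubleCommutator_left {R : Type*} [Ring R] {d1 d2 : R} (h1 : d1 * d1 = 0)
    (h : R) : Commute d1 (doubleCommutator d1 d2 h) := by
  simp only [Commute, SemiconjBy, doubleCommutator, mul_add, add_mul, ← mul_assoc, h1, zero_mul]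
  simp only [mul_assoc, h1, mul_zero, add_zero, zero_add]

theorem commute_doubleCommutator_right {R : Type*} [Ring R] {d1 d2 : R} (h2 : d2 * d2 = 0)
    (h12 : d1 * d2 + d2 * d1 = 0) (h : R) : Commute d2 (doubleCommutator d1 d2 h) := by
  have e : doubleCommutator d1 d2 h = -doubleCommutator d2 d1 h := by
    have e1 : d1 * d2 = -(d2 * d1) := eq_neg_of_add_eq_zero_left h12
    simp only [doubleCommutator, mul_sub, sub_mul, ← mul_assoc, e1]
    simp only [mul_assoc, e1, mul_neg, neg_mul]
    abel
  rw [e]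
  exact (commute_doubleCommutator_left h2 h).neg_right

theorem exists_splitting_of_ddbar (h1 : d1 ∘ₗ d1 = 0) (h2 : d2 ∘ₗ d2 = 0)
    (h12 : d1 ∘ₗ d2 + d2 ∘ₗ d1 = 0) {U : ℤ → Submodule K V} (hU : ∀ i, U i ≤ gV i)
    (hUker : ∀ i, ∀ u ∈ U i, d1 (d2 u) = 0 → u = 0) (i : ℤ) :
    ∃ h : V →ₗ[K] V, (∀ x, h x ∈ gV (i - 2)) ∧ (∀ u ∈ U i, h u = 0) ∧
      (∀ u ∈ U (i - 1), h (d1 u) = 0) ∧ (∀ u ∈ U (i - 1), h (d2 u) = 0) ∧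
      ∀ u ∈ U (i - 2), h (d1 (d2 u)) = u := by
  have e1 (x) : d1 (d1 x) = 0 := LinearMap.congr_fun h1 x
  have e2 (x) : d2 (d2 x) = 0 := LinearMap.congr_fun h2 x
  have e12 (x) : d2 (d1 x) = -d1 (d2 x) :=
    eq_neg_of_add_eq_zero_right (LinearMap.congr_fun h12 x)
  let A := U i ⊔ (U (i - 1)).map d1 ⊔ (U (i - 1)).map d2
  let g : U (i - 2) →ₗ[K] V ⧸ A := A.mkQ ∘ₗ d1 ∘ₗ d2 ∘ₗ (U (i - 2)).subtype
  have hg : ker g = ⊥ := by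
    refine (Submodule.eq_bot_iff _).2 fun w hw => Subtype.ext ?_
    have hwA : d1 (d2 w) ∈ A := by simpa [g] using hw
    obtain ⟨_, hy, _, ⟨u2, hu2, rfl⟩, e⟩ := mem_sup.1 hwA
    obtain ⟨u, hu, _, ⟨u1, hu1, rfl⟩, rfl⟩ := mem_sup.1 hy
    have hu0 : u = 0 := hUker i u hu <| by
      have := congrArg (fun x => d1 (d2 x)) e
      simpa [e1, e2, e12] using this
    subst hu0
    have hu10 : u1 = 0 := hUker _ u1 hu1 <| by
      have := congrArg d2 e
      simpa [e1, e2, e12] using this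
    subst hu10
    have hu20 : u2 = 0 := hUker _ u2 hu2 <| by
      have := congrArg d1 e
      simpa [e1, e2, e12] using this
    subst hu20
    exact hUker _ w w.2 (by simpa using e.symm)
  obtain ⟨r, hr⟩ := LinearMap.exists_leftInverse_of_injective g hg
  have hA {x : V} (hx : x ∈ A) : A.mkQ x = 0 := by simpa using hx
  refine ⟨(U (i - 2)).subtype ∘ₗ r ∘ₗ A.mkQ, fun x => hU _ (r (A.mkQ x)).2,
    fun u hu => ?_, fun u hu => ?_, fun u hu => ?_, fun u hu => ?_⟩
  · simp [hA (mem_sup_left (mem_sup_left hu) : u ∈ A), -mkQ_apply]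
  · simp [hA (mem_sup_left (mem_sup_right (mem_map_of_mem hu)) : d1 u ∈ A), -mkQ_apply]
  · simp [hA (mem_sup_right (mem_map_of_mem hu) : d2 u ∈ A), -mkQ_apply]
  · exact congrArg Subtype.val (LinearMap.congr_fun hr ⟨u, hu⟩)

/-- A `(k-1)`-connected bicomplex is contracted below degree `k` by an endomorphism of
degree `-2`. -/
theorem exists_homotopy_of_connected (hgV : DirectSum.IsInternal gV)
    (hd1 : ∀ i, (gV i).map d1 ≤ gV (i + 1)) (hd2 : ∀ i, (gV i).map d2 ≤ gV (i + 1))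
    (h1 : d1 ∘ₗ d1 = 0) (h2 : d2 ∘ₗ d2 = 0) (h12 : d1 ∘ₗ d2 + d2 ∘ₗ d1 = 0) (k : ℤ)
    (hconn : ∀ i ≤ k - 1, ker (d1 ∘ₗ d2) ⊓ gV i ≤ range d1 ⊔ range d2) :
    ∃ h : Module.End K V, (∀ i, (gV i).map h ≤ gV (i - 2)) ∧
      ∀ i ≤ k - 1, ∀ x ∈ gV i, (1 - doubleCommutator d1 d2 h) x = 0 := by
  have hU (i : ℤ) : ∃ U ≤ gV i, (∀ u ∈ U, d1 (d2 u) = 0 → u = 0) ∧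
      ∀ x ∈ gV i, ∃ u ∈ U, ∃ y ∈ gV i, d1 (d2 y) = 0 ∧ x = u + y := by
    obtain ⟨C, hC⟩ := Submodule.exists_isCompl (ker (d1 ∘ₗ d2) ⊓ gV i)
    refine ⟨C ⊓ gV i, inf_le_right, fun u hu hu0 => ?_, fun x hx => ?_⟩
    · exact (Submodule.disjoint_def.1 hC.disjoint) u ⟨by simpa using hu0, hu.2⟩ hu.1
    · obtain ⟨y, hy, c, hc, rfl⟩ := mem_sup.1 (hC.sup_eq_top ▸ mem_top : x ∈ _ ⊔ C)
      exact ⟨c, ⟨hc, by simpa using sub_mem hx hy.2⟩, y, hy.2, hy.1, add_comm _ _⟩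
  choose U hUg hUker hUdec using hU
  choose φ hφ using exists_splitting_of_ddbar h1 h2 h12 hUg hUker
  obtain ⟨h, hh⟩ := exists_linearMap_of_graded hgV φ
  refine ⟨h, ?_, ?_⟩
  · rintro i _ ⟨x, hx, rfl⟩
    rw [hh i x hx]
    exact (hφ i).1 x
  have hd1' {j x} (hx : x ∈ gV j) : d1 x ∈ gV (j + 1) := hd1 j (mem_map_of_mem hx)
  have hd2' {j x} (hx : x ∈ gV j) : d2 x ∈ gV (j + 1) := hd2 j (mem_map_of_mem hx)
  have e12 (x) : d2 (d1 x) = -d1 (d2 x) :=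
    eq_neg_of_add_eq_zero_right (LinearMap.congr_fun h12 x)
  let P : Module.End K V := 1 - doubleCommutator d1 d2 h
  have hP1 (x) : P (d1 x) = d1 (P x) := (LinearMap.congr_fun
    ((Commute.one_right d1).sub_right (commute_doubleCommutator_left h1 h)).eq x).symm
  have hP2 (x) : P (d2 x) = d2 (P x) := (LinearMap.congr_fun
    ((Commute.one_right d2).sub_right (commute_doubleCommutator_right h2 h12 h)).eq x).symm
  have hPU (j : ℤ) (u : V) (hu : u ∈ U j) : P u = 0 := by
    have a0 : h u = 0 := by rw [hh j u (hUg j hu), (hφ j).2.1 u hu]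
    have a1 : h (d1 u) = 0 := by
      rw [hh (j + 1) _ (hd1' (hUg j hu))]
      exact (hφ (j + 1)).2.2.1 u (by simpa using hu)
    have a2 : h (d2 u) = 0 := by
      rw [hh (j + 1) _ (hd2' (hUg j hu))]
      exact (hφ (j + 1)).2.2.2.1 u (by simpa using hu)
    have a3 : h (d1 (d2 u)) = u := by
      rw [hh (j + 1 + 1) _ (hd1' (hd2' (hUg j hu)))]
      exact (hφ (j + 1 + 1)).2.2.2.2 u
        (by rwa [show j + 1 + 1 - 2 = j by ring])
    simp [P, doubleCommutator, a0, a1, a2, a3, e12]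
  have hdec (j : ℤ) (hj : j ≤ k - 1) (x : V) (hx : x ∈ gV j) :
      ∃ a ∈ gV (j - 1), ∃ b ∈ gV (j - 1), P x = d1 (P a) + d2 (P b) := by
    obtain ⟨u, hu, y, hy, hy0, rfl⟩ := hUdec j x hx
    obtain ⟨a, ha, b, hb, rfl⟩ := exists_homogeneous_of_mem_range_sup_range hgV hd1 hd2 hy
      (hconn j hj ⟨by simpa using hy0, hy⟩)
    exact ⟨a, ha, b, hb, by rw [map_add, hPU j u hu, zero_add, map_add, hP1, hP2]⟩
  have hdd (j : ℤ) (x : V) (hx : x ∈ gV j) : d1 (d2 (P x)) = 0 := by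
    obtain ⟨u, hu, y, hy, hy0, rfl⟩ := hUdec j x hx
    rw [map_add, hPU j u hu, zero_add, ← hP2, ← hP1, hy0, map_zero]
  intro i hi x hx
  change P x = 0
  obtain ⟨a, ha, b, hb, e⟩ := hdec i hi x hx
  obtain ⟨a1, ha1, a2, ha2, ea⟩ := hdec _ (by omega) a ha
  obtain ⟨b1, hb1, b2, hb2, eb⟩ := hdec _ (by omega) b hb
  have e1 (x) : d1 (d1 x) = 0 := LinearMap.congr_fun h1 x
  have e2 (x) : d2 (d2 x) = 0 := LinearMap.congr_fun h2 x
  rw [e, ea, eb, map_add, map_add, e1, e2, e12, hdd _ a2 ha2, hdd _ b1 hb1]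
  simp

end Homotopy

section Tensor

variable {K V : Type*} [Field K] [AddCommGroup V] [Module K V] {n : ℕ}

/-- The endomorphism `a ⊗ ⋯ ⊗ a ⊗ b ⊗ 1 ⊗ ⋯ ⊗ 1` with `b` in position `i`. -/
noncomputable def tensorAt (a b : Module.End K V) (i : Fin n) :
    Module.End K (PiTensorProduct K (fun _ : Fin n => V)) :=
  PiTensorProduct.map fun l => if l < i then a else if l = i then b else 1

theorem map_mul_add_smul_mul (x y : Fin n → Module.End K V) (l : Fin n)
    (hxy : ∀ j ≠ l, x j * y j = y j * x j) (c : K) :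
    (PiTensorProduct.map x * PiTensorProduct.map y +
      c • (PiTensorProduct.map y * PiTensorProduct.map x) :
        Module.End K (PiTensorProduct K (fun _ : Fin n => V))) =
      PiTensorProduct.map (Function.update (fun j => x j * y j) l
        (x l * y l + c • (y l * x l))) := by
  rw [PiTensorProduct.map_update_add, PiTensorProduct.map_update_smul,
    ← PiTensorProduct.map_mul, ← PiTensorProduct.map_mul]
  congr 2
  · exact (Function.update_eq_self l _).symm
  · congr 1
    funext j
    by_cases hj : j = l
    · subst hj; simp
    · simp [hj, hxy j hj]

theorem tensorAt_commutator {s p d h : Module.End K V} (hsp : Commute s p) (hsh : Commute s h)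
    (hdp : Commute d p) (i j : Fin n) :
    tensorAt s d j * tensorAt p h i - tensorAt p h i * tensorAt s d j =
      if j = i then tensorAt (s * p) (d * h - h * d) i else 0 := by
  rw [sub_eq_add_neg, ← neg_one_smul K (_ * _), tensorAt, tensorAt,
    map_mul_add_smul_mul _ _ i]
  · by_cases hji : j = i
    · rw [if_pos hji]
      subst hji
      rw [tensorAt]
      congr 1
      funext l
      rcases lt_trichotomy l j with hl | rfl | hl
      · simp [hl, hl.ne]
      · simp [sub_eq_add_neg]
      · simp [hl.ne', hl.not_gt]
    · rw [if_neg hji, ← PiTensorProduct.mapMultilinear_apply]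
      refine MultilinearMap.map_coord_zero _ i ?_
      rcases lt_or_gt_of_ne hji with hl | hl
      · simp [hl.not_gt, Ne.symm hji]
      · simp [hl, hsh.eq]
  · intro l hl
    split_ifs <;> first | omega | simp [hsp.eq, hdp.eq]

theorem tensorAt_anticommutator {s p d q : Module.End K V} (hsp : Commute s p)
    (hss : s * s = 1) (hsd : s * d + d * s = 0) (hsq : s * q + q * s = 0)
    (hdp : Commute d p) (i j : Fin n) :
    tensorAt s d j * tensorAt (s * p) q i + tensorAt (s * p) q i * tensorAt s d j =
      if j = i then tensorAt p (d * q + q * d) i else 0 := by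
  have hspp : s * (s * p) = s * p * s := by rw [mul_assoc, ← hsp.eq]
  rw [← one_smul K (tensorAt (s * p) q i * _), tensorAt, tensorAt,
    map_mul_add_smul_mul _ _ (min i j)]
  · by_cases hji : j = i
    · rw [if_pos hji]
      subst hji
      rw [tensorAt, min_self]
      congr 1
      funext l
      rcases lt_trichotomy l j with hl | rfl | hl
      · simp [hl, hl.ne, ← mul_assoc, hss]
      · simp
      · simp [hl.ne', hl.not_gt]
    · rw [if_neg hji, ← PiTensorProduct.mapMultilinear_apply]
      refine MultilinearMap.map_coord_zero _ (min i j) ?_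
      rcases lt_or_gt_of_ne hji with hl | hl
      · have hds : d * s = -(s * d) := eq_neg_of_add_eq_zero_right hsd
        simp [hl, hl.le, ← mul_assoc, hds]
        simp [mul_assoc, hdp.eq]
      · simp [hl, hl.le, hsq]
  · intro l hl
    rcases le_total i j with hij | hij
    · rw [min_eq_left hij] at hl
      split_ifs <;> first | omega | simp
    · rw [min_eq_right hij] at hl
      split_ifs <;> first | omega | simp

theorem sum_tensorAt_anticommute {s d1 d2 : Module.End K V} (hss : s * s = 1)
    (hsd1 : s * d1 + d1 * s = 0) (hsd2 : s * d2 + d2 * s = 0) (h12 : d1 * d2 + d2 * d1 = 0) :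
    (∑ j : Fin n, tensorAt s d1 j) * (∑ j : Fin n, tensorAt s d2 j) +
      (∑ j : Fin n, tensorAt s d2 j) * (∑ j : Fin n, tensorAt s d1 j) = 0 := by
  have h0 (i : Fin n) : tensorAt (1 : Module.End K V) 0 i = 0 := by
    rw [tensorAt, ← PiTensorProduct.mapMultilinear_apply]
    exact MultilinearMap.map_coord_zero _ i (by simp)
  have h (i j : Fin n) : tensorAt s d1 j * tensorAt s d2 i + tensorAt s d2 i * tensorAt s d1 j =
      0 := by
    simpa [h12, h0] using
      tensorAt_anticommutator (Commute.one_right s) hss hsd1 hsd2 (Commute.one_right d1) i j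
  rw [Finset.sum_mul_sum, Finset.sum_mul_sum, Finset.sum_comm, ← Finset.sum_add_distrib]
  simp only [← Finset.sum_add_distrib, h, Finset.sum_const_zero]

theorem sum_tensorAt_one_sub (p : Module.End K V) :
    ∑ i : Fin n, tensorAt p (1 - p) i = 1 - PiTensorProduct.map (fun _ => p) := by
  let M (i : ℕ) : Module.End K (PiTensorProduct K (fun _ : Fin n => V)) :=
    PiTensorProduct.map fun l => if (l : ℕ) < i then p else 1
  have hM (i : Fin n) : tensorAt p (1 - p) i = M i - M (i + 1) := by
    have e : (fun l : Fin n => if l < i then p else if l = i then 1 - p else 1) =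
        Function.update (fun l => if l < i then p else 1) i (1 - p) := by
      funext l
      by_cases hl : l = i
      · subst hl; simp
      · simp [hl]
    rw [tensorAt, e, ← PiTensorProduct.mapMultilinear_apply, MultilinearMap.map_update_sub]
    simp only [PiTensorProduct.mapMultilinear_apply]
    congr 2 <;> funext l
    · by_cases hl : l = i
      · subst hl; simp
      · simp [hl]
    · by_cases hl : l = i
      · subst hl; simp
      · have : (l : ℕ) < i + 1 ↔ l < i := by omega
        simp [hl, this]
  simp only [hM]
  rw [Fin.sum_univ_eq_sum_range (fun i => M i - M (i + 1)), Finset.sum_range_sub']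
  congr 1
  · simp only [M, Nat.not_lt_zero, if_false]
    exact PiTensorProduct.map_one
  · simp [M]

theorem doubleCommutator_sum_tensorAt {s h d1 d2 p : Module.End K V} (hss : s * s = 1)
    (hsh : Commute s h) (hsd1 : s * d1 + d1 * s = 0) (hsd2 : s * d2 + d2 * s = 0)
    (hp : p = 1 - doubleCommutator d1 d2 h) (hdp1 : Commute d1 p) (hdp2 : Commute d2 p) :
    doubleCommutator (∑ j : Fin n, tensorAt s d1 j) (∑ j : Fin n, tensorAt s d2 j)
      (∑ i : Fin n, tensorAt p h i) = 1 - PiTensorProduct.map (fun _ => p) := by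
  have hsd1' : s * d1 = -(d1 * s) := eq_neg_of_add_eq_zero_left hsd1
  have hsd2' : s * d2 = -(d2 * s) := eq_neg_of_add_eq_zero_left hsd2
  have hsq : s * (d2 * h - h * d2) + (d2 * h - h * d2) * s = 0 := by
    have e1 : s * (d2 * h) = -(d2 * h * s) := by
      rw [← mul_assoc, hsd2', neg_mul, mul_assoc, hsh.eq, mul_assoc]
    have e2 : s * (h * d2) = -(h * d2 * s) := by
      rw [← mul_assoc, hsh.eq, mul_assoc, hsd2', mul_neg, mul_assoc]
    rw [mul_sub, sub_mul, e1, e2]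
    abel
  have hsp : Commute s p := by
    rw [hp]
    refine (Commute.one_right s).sub_right ?_
    have hsq' := eq_neg_of_add_eq_zero_left hsq
    rw [Commute, SemiconjBy, doubleCommutator, mul_add, add_mul, ← mul_assoc, ← mul_assoc, hsd1',
      hsq', neg_mul, neg_mul, mul_assoc, hsq', mul_assoc, hsd1', mul_neg, mul_neg, neg_neg,
      neg_neg, mul_assoc, mul_assoc]
  have hcomm : (∑ j : Fin n, tensorAt s d2 j) * (∑ i : Fin n, tensorAt p h i) -
      (∑ i : Fin n, tensorAt p h i) * (∑ j : Fin n, tensorAt s d2 j) =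
      ∑ i : Fin n, tensorAt (s * p) (d2 * h - h * d2) i := by
    rw [Finset.sum_mul_sum, Finset.sum_mul_sum, Finset.sum_comm, ← Finset.sum_sub_distrib]
    refine Finset.sum_congr rfl fun i _ => ?_
    rw [← Finset.sum_sub_distrib]
    simp [tensorAt_commutator hsp hsh hdp2]
  rw [doubleCommutator, hcomm, Finset.sum_mul_sum, Finset.sum_mul_sum, Finset.sum_comm,
    ← Finset.sum_add_distrib, ← sum_tensorAt_one_sub]
  refine Finset.sum_congr rfl fun i _ => ?_
  rw [← Finset.sum_add_distrib]
  simp only [tensorAt_anticommutator hsp hss hsd1 hsq hdp1, Finset.sum_ite_eq', Finset.mem_univ,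
    if_true]
  rw [hp, sub_sub_cancel, doubleCommutator]

theorem tensorAt_tprod_of_homogeneous {gV : ℤ → Submodule K V} {s : Module.End K V}
    (hs : ∀ i, ∀ x ∈ gV i, s x = ((-1 : K) ^ i) • x) (d : Module.End K V) (i : Fin n)
    (f : Fin n → ℤ) (v : Fin n → V) (hv : ∀ i, v i ∈ gV (f i)) :
    tensorAt s d i (PiTensorProduct.tprod K v) = ((-1 : K) ^ (∑ j ∈ Finset.Iio i, f j)) •
      PiTensorProduct.tprod K (Function.update v i (d (v i))) := by
  have hprod : (-1 : K) ^ (∑ j ∈ Finset.Iio i, f j) =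
      ∏ l, if l < i then (-1 : K) ^ f l else 1 := by
    rw [Finset.prod_ite, Finset.prod_const_one, mul_one,
      show Finset.univ.filter (· < i) = Finset.Iio i by ext; simp]
    induction Finset.Iio i using Finset.induction_on with
    | empty => simp
    | insert a t ha ih =>
      rw [Finset.sum_insert ha, Finset.prod_insert ha, zpow_add₀ (by simp), ih]
  rw [hprod, ← MultilinearMap.map_smul_univ, tensorAt, PiTensorProduct.map_tprod]
  congr 1
  funext l
  rcases lt_trichotomy l i with hl | rfl | hl
  · simp [hl, hl.ne, hs _ _ (hv l)]
  · simp
  · simp [hl.ne', hl.not_gt]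

end Tensor

theorem mem_range_sup_range_of_doubleCommutator {K T : Type*} [Field K] [AddCommGroup T]
    [Module K T] {D1 D2 H : Module.End K T} {x : T} (hx : doubleCommutator D1 D2 H x = x)
    (h21 : D2 (D1 x) = 0) : x ∈ range D1 ⊔ range D2 := by
  rw [← hx]
  simp only [doubleCommutator, LinearMap.add_apply, Module.End.mul_apply, LinearMap.sub_apply,
    h21, map_zero, sub_zero]
  exact add_mem_sup (mem_range_self _ _) (mem_range_self _ _)

/-- Let `V` be a bicomplex with `H_A^i(V) = 0` for all `i ≤ k-1`
(`V` is `(k-1)`-connected).  Let `T = V^{⊗n}` be its `n`-th tensor power with the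
induced grading and the Koszul-signed differentials, and let `E` (playing the role
of the exterior power `⋀ⁿV`, which in characteristic zero is a direct summand of
`V^{⊗n}` as a bicomplex) be any graded bicomplex retract of `T`.  Then
`H_A^i(E) = 0` for all `i ≤ n·k - 1`. -/
theorem statement7
    {K : Type*} [Field K] [CharZero K]
    {V : Type*} [AddCommGroup V] [Module K V]
    (gV : ℤ → Submodule K V) (hgV : DirectSum.IsInternal gV)
    (dV1 dV2 : V →ₗ[K] V)
    (hdV1g : ∀ i, (gV i).map dV1 ≤ gV (i + 1))
    (hdV2g : ∀ i, (gV i).map dV2 ≤ gV (i + 1))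
    (hdV1sq : dV1 ∘ₗ dV1 = 0) (hdV2sq : dV2 ∘ₗ dV2 = 0)
    (hVanti : dV1 ∘ₗ dV2 + dV2 ∘ₗ dV1 = 0)
    (k : ℤ) (n : ℕ) (hn : 1 ≤ n)
    (hconn : ∀ i ≤ k - 1, ker (dV1 ∘ₗ dV2) ⊓ gV i ≤ range dV1 ⊔ range dV2)
    -- the `n`-fold tensor power with its grading and Koszul differentials
    (gT : ℤ → Submodule K (PiTensorProduct K (fun _ : Fin n => V)))
    (hgT : ∀ m, gT m = ⨆ f : Fin n → ℤ, ⨆ _ : (∑ i, f i) = m,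
      Submodule.span K {x | ∃ v : Fin n → V, (∀ i, v i ∈ gV (f i)) ∧
        x = PiTensorProduct.tprod K v})
    (hgTint : DirectSum.IsInternal gT)
    (D1 D2 : PiTensorProduct K (fun _ : Fin n => V) →ₗ[K]
             PiTensorProduct K (fun _ : Fin n => V))
    (hD1 : ∀ (f : Fin n → ℤ) (v : Fin n → V), (∀ i, v i ∈ gV (f i)) →
      D1 (PiTensorProduct.tprod K v) = ∑ i : Fin n,
        ((-1 : K) ^ (∑ j ∈ Finset.Iio i, f j)) •
          PiTensorProduct.tprod K (Function.update v i (dV1 (v i))))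
    (hD2 : ∀ (f : Fin n → ℤ) (v : Fin n → V), (∀ i, v i ∈ gV (f i)) →
      D2 (PiTensorProduct.tprod K v) = ∑ i : Fin n,
        ((-1 : K) ^ (∑ j ∈ Finset.Iio i, f j)) •
          PiTensorProduct.tprod K (Function.update v i (dV2 (v i))))
    -- `E` is a direct summand of the tensor power as a graded bicomplex
    {E : Type*} [AddCommGroup E] [Module K E]
    (gE : ℤ → Submodule K E) (hgE : DirectSum.IsInternal gE)
    (DE1 DE2 : E →ₗ[K] E)
    (hDE1g : ∀ i, (gE i).map DE1 ≤ gE (i + 1))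
    (hDE2g : ∀ i, (gE i).map DE2 ≤ gE (i + 1))
    (ι : E →ₗ[K] PiTensorProduct K (fun _ : Fin n => V))
    (π : PiTensorProduct K (fun _ : Fin n => V) →ₗ[K] E)
    (hretract : π ∘ₗ ι = LinearMap.id)
    (hιg : ∀ i, (gE i).map ι ≤ gT i) (hπg : ∀ i, (gT i).map π ≤ gE i)
    (hι1 : ι ∘ₗ DE1 = D1 ∘ₗ ι) (hι2 : ι ∘ₗ DE2 = D2 ∘ₗ ι)
    (hπ1 : π ∘ₗ D1 = DE1 ∘ₗ π) (hπ2 : π ∘ₗ D2 = DE2 ∘ₗ π) :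
    ∀ i ≤ (n : ℤ) * k - 1, ker (DE1 ∘ₗ DE2) ⊓ gE i ≤ range DE1 ⊔ range DE2 := by
  obtain ⟨h, hhg, hhP⟩ := exists_homotopy_of_connected hgV hdV1g hdV2g hdV1sq hdV2sq hVanti k hconn
  obtain ⟨s, hs⟩ := exists_gradedSign hgV
  have hss : s * s = 1 := linearMap_ext_of_graded hgV fun i x hx => by
    simp only [Module.End.mul_apply, Module.End.one_apply, hs i x hx, map_smul, smul_smul]
    rw [← mul_zpow]
    simp
  have hsh : Commute s h := linearMap_ext_of_graded hgV fun i x hx => by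
    simp only [Module.End.mul_apply, hs i x hx, hs _ _ (hhg i (mem_map_of_mem hx)), map_smul]
    rw [zpow_sub₀ (by simp)]
    simp
  have hsd {d : V →ₗ[K] V} (hd : ∀ i, (gV i).map d ≤ gV (i + 1)) : s * d + d * s = 0 :=
    linearMap_ext_of_graded hgV fun i x hx => by
      simp only [LinearMap.add_apply, Module.End.mul_apply, hs i x hx,
        hs _ _ (hd i (mem_map_of_mem hx)), map_smul]
      rw [zpow_add₀ (by simp)]
      simp
  let P : Module.End K V := 1 - doubleCommutator dV1 dV2 h
  have hD {d : V →ₗ[K] V} {D : Module.End K (PiTensorProduct K (fun _ : Fin n => V))}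
      (hD : ∀ (f : Fin n → ℤ) (v : Fin n → V), (∀ i, v i ∈ gV (f i)) →
        D (PiTensorProduct.tprod K v) = ∑ i : Fin n,
          ((-1 : K) ^ (∑ j ∈ Finset.Iio i, f j)) •
            PiTensorProduct.tprod K (Function.update v i (d (v i)))) :
      D = ∑ j, tensorAt s d j := by
    refine linearMap_ext_of_graded hgTint fun m => ?_
    change gT m ≤ eqLocus D _
    rw [hgT]
    refine iSup₂_le fun f _ => span_le.2 ?_
    rintro _ ⟨v, hv, rfl⟩
    rw [SetLike.mem_coe, mem_eqLocus, hD f v hv, LinearMap.sum_apply]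
    exact Finset.sum_congr rfl fun i _ => (tensorAt_tprod_of_homogeneous hs d i f v hv).symm
  have key := doubleCommutator_sum_tensorAt (n := n) hss hsh (hsd hdV1g) (hsd hdV2g)
    (p := P) rfl ((Commute.one_right _).sub_right (commute_doubleCommutator_left hdV1sq h))
    ((Commute.one_right _).sub_right (commute_doubleCommutator_right hdV2sq hVanti h))
  have hanti := sum_tensorAt_anticommute (n := n) hss (hsd hdV1g) (hsd hdV2g) hVanti
  rw [← hD hD1, ← hD hD2] at key hanti
  have hPT (m : ℤ) (hm : m ≤ n * k - 1) :
      gT m ≤ ker (PiTensorProduct.map (fun _ : Fin n => P)) := by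
    rw [hgT]
    refine iSup₂_le fun f hf => span_le.2 ?_
    rintro _ ⟨v, hv, rfl⟩
    obtain ⟨j, hj⟩ : ∃ j, f j ≤ k - 1 := by
      by_contra! hlt
      have : ∑ _j : Fin n, k ≤ ∑ j, f j := Finset.sum_le_sum fun j _ => by linarith [hlt j]
      simp at this
      omega
    rw [SetLike.mem_coe, LinearMap.mem_ker, PiTensorProduct.map_tprod]
    exact MultilinearMap.map_coord_zero _ j (hhP _ hj _ (hv j))
  rintro i hi x ⟨hx0, hx⟩
  have hx0 : DE1 (DE2 x) = 0 := hx0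
  have hιx : ι x ∈ gT i := hιg i (mem_map_of_mem hx)
  have hι1 (y) : ι (DE1 y) = D1 (ι y) := LinearMap.congr_fun hι1 y
  have hι2 (y) : ι (DE2 y) = D2 (ι y) := LinearMap.congr_fun hι2 y
  have hπ1 (y) : π (D1 y) = DE1 (π y) := LinearMap.congr_fun hπ1 y
  have hπ2 (y) : π (D2 y) = DE2 (π y) := LinearMap.congr_fun hπ2 y
  have hx12 : D1 (D2 (ι x)) = 0 := by rw [← hι2, ← hι1, hx0, map_zero]
  have hfix : doubleCommutator D1 D2 (∑ i : Fin n, tensorAt P h i) (ι x) = ι x := by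
    rw [key, LinearMap.sub_apply, hPT i hi hιx, sub_zero, Module.End.one_apply]
  have hx21 : D2 (D1 (ι x)) = 0 := by
    simpa [hx12] using LinearMap.congr_fun hanti (ι x)
  obtain ⟨_, ⟨a, rfl⟩, _, ⟨b, rfl⟩, hab⟩ :=
    mem_sup.1 (mem_range_sup_range_of_doubleCommutator hfix hx21)
  have hx : x = DE1 (π a) + DE2 (π b) := by
    rw [← hπ1, ← hπ2, ← map_add, hab]
    exact (LinearMap.congr_fun hretract x).symm
  rw [hx]
  exact add_mem_sup (mem_range_self _ _) (mem_range_self _ _)
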